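/- Let R, B : [0,1] → ℝ be continuous curves with R(0) < B(0). If some traversal of (R,B) maintains positive separation, then there exists a traversal (f,g) of (R,B) that maintains positive separation and a time t₀ ∈ [0,1] such that R(f(t₀)) = min R and B(g(t₀)) = max B, i.e., at time t₀ the first agent is at the leftmost point of R and the second agent is at the rightmost point of B. -/

import Mathlib

/-- A reparametrization: a continuous, nondecreasing, surjective map of `[0,1]` onto `[0,1]`. -/
def Reparam (f : ℝ → ℝ) : Prop :=
  ContinuousOn f (Set.Icc 0 1) ∧ MonotoneOn f (Set.Icc 0 1) ∧
    Set.MapsTo f (Set.Icc 0 1) (Set.Icc 0 1) ∧ Set.SurjOn f (Set.Icc 0 1) (Set.Icc 0 1)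

theorem Reparam.comp {f p : ℝ → ℝ} (hf : Reparam f) (hp : Reparam p) : Reparam (f ∘ p) :=
  ⟨hf.1.comp hp.1 hp.2.2.1, hf.2.1.comp hp.2.1 hp.2.2.1, hf.2.2.1.comp hp.2.2.1,
    hf.2.2.2.comp hp.2.2.2⟩

theorem Reparam.map_zero {f : ℝ → ℝ} (hf : Reparam f) : f 0 = 0 := by
  have h0 : (0 : ℝ) ∈ Set.Icc (0 : ℝ) 1 := by simp
  obtain ⟨x, hx, hfx⟩ := hf.2.2.2 h0
  exact le_antisymm (hfx ▸ hf.2.1 h0 hx hx.1) (hf.2.2.1 h0).1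

theorem Reparam.of_monotone {p : ℝ → ℝ} (hc : Continuous p) (hm : Monotone p)
    (h0 : p 0 = 0) (h1 : p 1 = 1) : Reparam p := by
  refine ⟨hc.continuousOn, hm.monotoneOn _, fun x hx => ⟨h0 ▸ hm hx.1, h1 ▸ hm hx.2⟩, ?_⟩
  have h := intermediate_value_Icc zero_le_one (hc.continuousOn (s := Set.Icc 0 1))
  rwa [h0, h1] at h

/-- A monotone path in the unit square from `(0, 0)` to `(1, 1)` through `(s, u)` that stays on
the diagonal, on the line `x = s`, or on the line `y = u`; here for `s ≤ u`. -/
theorem exists_reparam_pair_of_le {s u : ℝ} (hs : 0 ≤ s) (hu : u ≤ 1) (hsu : s ≤ u) :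
    ∃ p q : ℝ → ℝ, Reparam p ∧ Reparam q ∧ (∃ t ∈ Set.Icc (0 : ℝ) 1, p t = s ∧ q t = u) ∧
      ∀ t, p t = q t ∨ p t = s ∨ q t = u := by
  have hL : 0 < 1 + (u - s) := by linarith
  have hreparam : ∀ c : ℝ, 0 ≤ c → c ≤ 1 → Reparam fun t =>
      max (min ((1 + (u - s)) * t) c) ((1 + (u - s)) * t - (u - s)) := by
    intro c hc0 hc1
    refine Reparam.of_monotone (by fun_prop) (fun x y hxy => ?_) ?_ ?_
    · gcongr
    · simp [hc0, hsu]
    · simp [hc1]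
  refine ⟨_, _, hreparam s hs (hsu.trans hu), hreparam u (hs.trans hsu) hu,
    ⟨u / (1 + (u - s)), ⟨div_nonneg (hs.trans hsu) hL.le, ?_⟩, ?_, ?_⟩, fun t => ?_⟩
  · rw [div_le_one hL]; linarith
  · simp only [mul_div_cancel₀ u hL.ne', min_eq_right hsu]
    simp
  · simp only [mul_div_cancel₀ u hL.ne', min_self]
    simp [hsu]
  · generalize (1 + (u - s)) * t = x
    grind

theorem exists_reparam_pair {s u : ℝ} (hs : s ∈ Set.Icc (0 : ℝ) 1) (hu : u ∈ Set.Icc (0 : ℝ) 1) :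
    ∃ p q : ℝ → ℝ, Reparam p ∧ Reparam q ∧ (∃ t ∈ Set.Icc (0 : ℝ) 1, p t = s ∧ q t = u) ∧
      ∀ t, p t = q t ∨ p t = s ∨ q t = u := by
  rcases le_total s u with h | h
  · exact exists_reparam_pair_of_le hs.1 hu.2 h
  · obtain ⟨q, p, hq, hp, ⟨t, ht, hqt, hpt⟩, hpq⟩ := exists_reparam_pair_of_le hu.1 hs.2 h
    exact ⟨p, q, hp, hq, ⟨t, ht, hpt, hqt⟩, fun t => by grind⟩

/-- A separated traversal keeps the initial order of the two agents. -/
theorem Reparam.lt_of_ne {R B f g : ℝ → ℝ}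
    (hR : ContinuousOn R (Set.Icc 0 1)) (hB : ContinuousOn B (Set.Icc 0 1)) (h0 : R 0 < B 0)
    (hf : Reparam f) (hg : Reparam g) (hsep : ∀ t ∈ Set.Icc (0 : ℝ) 1, R (f t) ≠ B (g t)) :
    ∀ t ∈ Set.Icc (0 : ℝ) 1, R (f t) < B (g t) := by
  intro t ht
  by_contra! hle
  have hcont : ContinuousOn (fun x => R (f x) - B (g x)) (Set.Icc 0 t) :=
    ((hR.comp hf.1 hf.2.2.1).sub (hB.comp hg.1 hg.2.2.1)).mono (Set.Icc_subset_Icc_right ht.2)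
  obtain ⟨x, hx, hxe⟩ := intermediate_value_Icc ht.1 hcont (show (0 : ℝ) ∈ _ from
    ⟨by simp only [hf.map_zero, hg.map_zero]; linarith, by linarith⟩)
  exact hsep x ⟨hx.1, hx.2.trans ht.2⟩ (sub_eq_zero.mp hxe)

/-- If `R, B : [0,1] → ℝ` are continuous with `R 0 < B 0` and some traversal of `(R, B)`
maintains positive separation, then there exists a traversal `(f, g)` maintaining positive
separation and a time `t₀ ∈ [0,1]` at which the first agent is at the leftmost point of `R`
and the second agent is at the rightmost point of `B`. -/
theorem stmt1 (R B : ℝ → ℝ)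
    (hR : ContinuousOn R (Set.Icc 0 1)) (hB : ContinuousOn B (Set.Icc 0 1))
    (h0 : R 0 < B 0)
    (f₀ g₀ : ℝ → ℝ) (hf₀ : Reparam f₀) (hg₀ : Reparam g₀)
    (hsep₀ : ∀ t ∈ Set.Icc (0:ℝ) 1, R (f₀ t) ≠ B (g₀ t)) :
    ∃ f g : ℝ → ℝ, Reparam f ∧ Reparam g ∧
      (∀ t ∈ Set.Icc (0:ℝ) 1, R (f t) ≠ B (g t)) ∧
      ∃ t₀ ∈ Set.Icc (0:ℝ) 1,
        R (f t₀) = sInf (R '' Set.Icc 0 1) ∧ B (g t₀) = sSup (B '' Set.Icc 0 1) := by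
  have hlt := Reparam.lt_of_ne hR hB h0 hf₀ hg₀ hsep₀
  obtain ⟨a, ha, hamin, hale⟩ := isCompact_Icc.exists_sInf_image_eq_and_le
    (Set.nonempty_Icc.mpr zero_le_one) hR
  obtain ⟨b, hb, hbmax, hbge⟩ := isCompact_Icc.exists_sSup_image_eq_and_ge
    (Set.nonempty_Icc.mpr zero_le_one) hB
  obtain ⟨s, hs, rfl⟩ := hf₀.2.2.2 ha
  obtain ⟨u, hu, rfl⟩ := hg₀.2.2.2 hb
  obtain ⟨p, q, hp, hq, ⟨t₀, ht₀, hpt, hqt⟩, hpq⟩ := exists_reparam_pair hs hu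
  refine ⟨f₀ ∘ p, g₀ ∘ q, hf₀.comp hp, hg₀.comp hq, fun t ht => ne_of_lt ?_, t₀, ht₀, ?_, ?_⟩
  · have hpt' := hp.2.2.1 ht
    have hqt' := hq.2.2.1 ht
    simp only [Function.comp_apply]
    rcases hpq t with h | h | h
    · exact h ▸ hlt _ hpt'
    · exact h ▸ (hale _ (hf₀.2.2.1 hqt')).trans_lt (hlt _ hqt')
    · exact h ▸ (hlt _ hpt').trans_le (hbge _ (hg₀.2.2.1 hpt'))
  · simp [hpt, hamin]
  · simp [hqt, hbmax]
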